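/- For all fixed reals 0 < α < 1/2 and 0 < ρ < 1 there exist constants c, k, n₀ ∈ ℕ such that the following holds for every n ≥ n₀, every integer r with 2 ≤ r ≤ (1−ρ)n, all ℓ, u ∈ ℕⁿ with [ℓᵢ,uᵢ] ⊆ [r − r^α, r + r^α] and uᵢ ≤ ℓᵢ + 1 for all i, and every m ∈ ℕ with Σᵢℓᵢ ≤ 2m and 2(m+1) ≤ Σᵢuᵢ: both |G_{m+1}(ℓ,u)| ≤ c · n^k · |G_m(ℓ,u)| and |G_m(ℓ,u)| ≤ c · n^k · |G_{m+1}(ℓ,u)| hold; that is, consecutive ratios of the sequence (|G_m(ℓ,u)|)_m are polynomially bounded. -/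

import Mathlib

/-- The degree of vertex `i` in a simple graph on `Fin n`. -/
noncomputable def degOf {n : ℕ} (G : SimpleGraph (Fin n)) (i : Fin n) : ℕ :=
  (G.neighborSet i).ncard

/-- `Gm n ℓ u m`: graphs on `[n]` with exactly `m` edges and degrees within `[ℓ,u]`. -/
noncomputable def Gm (n : ℕ) (ℓ u : Fin n → ℕ) (m : ℕ) : Set (SimpleGraph (Fin n)) :=
  {G | (∀ i, ℓ i ≤ degOf G i ∧ degOf G i ≤ u i) ∧ G.edgeSet.ncard = m}

lemma degOf_eq_degree {n : ℕ} (G : SimpleGraph (Fin n)) (i : Fin n)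
    [Fintype (G.neighborSet i)] : degOf G i = G.degree i := by
  rw [degOf, Set.ncard_eq_toFinset_card', SimpleGraph.degree, SimpleGraph.neighborFinset]

/-- The sum of the degrees is twice the number of edges. -/
lemma sum_degOf {n : ℕ} (G : SimpleGraph (Fin n)) : ∑ i, degOf G i = 2 * G.edgeSet.ncard := by
  classical
  simp_rw [degOf_eq_degree]
  rw [G.sum_degrees_eq_twice_card_edges, ← SimpleGraph.coe_edgeFinset, Set.ncard_coe_finset]

open Classical in
lemma degOf_eq_card_filter {n : ℕ} (G : SimpleGraph (Fin n)) (i : Fin n) :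
    degOf G i = (Finset.univ.filter fun j => G.Adj i j).card := by
  rw [degOf, ← Set.ncard_coe_finset]
  congr 1
  ext j
  simp

lemma degOf_compl_add {n : ℕ} (G : SimpleGraph (Fin n)) (i : Fin n) :
    degOf Gᶜ i + degOf G i + 1 = n := by
  classical
  have h := G.degree_compl i
  have hlt := G.degree_lt_card_verts i
  rw [← degOf_eq_degree, ← degOf_eq_degree] at h
  rw [← degOf_eq_degree] at hlt
  simp only [Fintype.card_fin] at h hlt
  omega

lemma symmDiff_edge_adj {n : ℕ} (G : SimpleGraph (Fin n)) (a b v w : Fin n) :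
    (symmDiff G (SimpleGraph.edge a b)).Adj v w ↔
      (G.Adj v w ∧ ¬ (v = a ∧ w = b ∨ v = b ∧ w = a)) ∨
      (¬ G.Adj v w ∧ (v = a ∧ w = b ∨ v = b ∧ w = a) ∧ v ≠ w) := by
  have : G.Adj v w → v ≠ w := fun h => h.ne
  simp only [symmDiff_def, SimpleGraph.sup_adj, SimpleGraph.sdiff_adj, SimpleGraph.edge_adj]
  tauto

/-- Removing an edge lowers the degrees of its two ends by one. -/
lemma degOf_symmDiff_edge_of_adj {n : ℕ} {G : SimpleGraph (Fin n)} {a b : Fin n}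
    (h : G.Adj a b) (v : Fin n) :
    (degOf (symmDiff G (SimpleGraph.edge a b)) v : ℤ) =
      degOf G v - (if v = a then 1 else 0) - (if v = b then 1 else 0) := by
  have hab := h.ne
  have key : ∀ x y : Fin n, G.Adj x y → (x = a ∧ y = b ∨ x = b ∧ y = a) →
      degOf (symmDiff G (SimpleGraph.edge a b)) x + 1 = degOf G x := by
    intro x y hxy hx
    have e : (symmDiff G (SimpleGraph.edge a b)).neighborSet x = G.neighborSet x \ {y} := by
      ext w
      simp only [SimpleGraph.mem_neighborSet, symmDiff_edge_adj, Set.mem_sdiff,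
        Set.mem_singleton_iff]
      grind
    rw [degOf, e, Set.ncard_sdiff_singleton_add_one (by simpa using hxy), degOf]
  by_cases hva : v = a
  · subst hva
    have := key v b h (by simp)
    simp [hab]
    omega
  by_cases hvb : v = b
  · subst hvb
    have := key v a h.symm (by simp)
    simp [hab.symm]
    omega
  · have e : (symmDiff G (SimpleGraph.edge a b)).neighborSet v = G.neighborSet v := by
      ext w
      simp only [SimpleGraph.mem_neighborSet, symmDiff_edge_adj]
      tauto
    simp [degOf, e, hva, hvb]

/-- Adding an edge raises the degrees of its two ends by one. -/
lemma degOf_symmDiff_edge_of_not_adj {n : ℕ} {G : SimpleGraph (Fin n)} {a b : Fin n}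
    (hab : a ≠ b) (h : ¬ G.Adj a b) (v : Fin n) :
    (degOf (symmDiff G (SimpleGraph.edge a b)) v : ℤ) =
      degOf G v + (if v = a then 1 else 0) + (if v = b then 1 else 0) := by
  have h1 : (symmDiff G (SimpleGraph.edge a b)).Adj a b := by
    simp [symmDiff_edge_adj, h, hab]
  have h2 := degOf_symmDiff_edge_of_adj h1 v
  rw [symmDiff_symmDiff_cancel_right] at h2
  omega

/-- The edges used an odd number of times by the walk `p 0, …, p 5` (repeated vertices allowed). -/
def walkParity {n : ℕ} (p : Fin 6 → Fin n) : SimpleGraph (Fin n) :=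
  symmDiff (symmDiff (symmDiff (symmDiff (SimpleGraph.edge (p 0) (p 1))
    (SimpleGraph.edge (p 1) (p 2))) (SimpleGraph.edge (p 2) (p 3)))
    (SimpleGraph.edge (p 3) (p 4))) (SimpleGraph.edge (p 4) (p 5))

/-- Toggling an alternating walk of length one, three or five that starts and ends with an edge
lowers the degrees of its two ends by one and keeps all the others. -/
lemma exists_walkParity_of_alternating {n : ℕ} {G : SimpleGraph (Fin n)} {s t : Fin n}
    (hst : s ≠ t)
    (h : G.Adj s t ∨ (∃ a b, G.Adj s a ∧ a ≠ b ∧ ¬ G.Adj a b ∧ G.Adj b t) ∨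
      ∃ a b x y, G.Adj s a ∧ a ≠ x ∧ ¬ G.Adj a x ∧ G.Adj x y ∧ y ≠ b ∧ ¬ G.Adj y b ∧
        G.Adj b t) :
    ∃ p : Fin 6 → Fin n, ∀ v, (degOf (symmDiff G (walkParity p)) v : ℤ) =
      degOf G v - (if v = s then 1 else 0) - (if v = t then 1 else 0) := by
  by_cases h1 : G.Adj s t
  · refine ⟨![s, t, t, t, t, t], fun v => ?_⟩
    rw [← degOf_symmDiff_edge_of_adj h1 v]
    simp [walkParity]
  replace h := h.resolve_left h1
  rcases h with ⟨a, b, hsa, hab, nab, hbt⟩ | ⟨a, b, x, y, hsa, hax, nax, hxy, hyb, nyb, hbt⟩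
  · refine ⟨![s, a, b, t, t, t], fun v => ?_⟩
    have := hsa.ne
    have := hbt.ne
    have e1 : ¬ (symmDiff G (SimpleGraph.edge s a)).Adj a b := by
      rw [symmDiff_edge_adj]; grind
    have e2 : (symmDiff (symmDiff G (SimpleGraph.edge s a)) (SimpleGraph.edge a b)).Adj b t := by
      simp only [symmDiff_edge_adj]; grind [SimpleGraph.adj_comm]
    have f := degOf_symmDiff_edge_of_adj e2 v
    rw [degOf_symmDiff_edge_of_not_adj hab e1 v, degOf_symmDiff_edge_of_adj hsa v] at f
    simp only [walkParity, Matrix.cons_val, SimpleGraph.edge_self_eq_bot, symmDiff_bot,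
      ← symmDiff_assoc]
    rw [f]; ring
  · refine ⟨![s, a, x, y, b, t], fun v => ?_⟩
    have := hsa.ne
    have := hbt.ne
    have := hxy.ne
    have e1 : ¬ (symmDiff G (SimpleGraph.edge s a)).Adj a x := by
      rw [symmDiff_edge_adj]; grind [SimpleGraph.adj_comm]
    have e2 : (symmDiff (symmDiff G (SimpleGraph.edge s a)) (SimpleGraph.edge a x)).Adj x y := by
      simp only [symmDiff_edge_adj]; grind [SimpleGraph.adj_comm]
    have e3 : ¬ (symmDiff (symmDiff (symmDiff G (SimpleGraph.edge s a)) (SimpleGraph.edge a x))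
        (SimpleGraph.edge x y)).Adj y b := by
      simp only [symmDiff_edge_adj]; grind [SimpleGraph.adj_comm]
    have e4 : (symmDiff (symmDiff (symmDiff (symmDiff G (SimpleGraph.edge s a))
        (SimpleGraph.edge a x)) (SimpleGraph.edge x y)) (SimpleGraph.edge y b)).Adj b t := by
      simp only [symmDiff_edge_adj]; grind [SimpleGraph.adj_comm]
    have f := degOf_symmDiff_edge_of_adj e4 v
    rw [degOf_symmDiff_edge_of_not_adj hyb e3 v, degOf_symmDiff_edge_of_adj e2 v,
      degOf_symmDiff_edge_of_not_adj hax e1 v, degOf_symmDiff_edge_of_adj hsa v] at f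
    simp only [walkParity, Matrix.cons_val, ← symmDiff_assoc]
    rw [f]; ring

open Classical in
/-- Double counting of the edges leaving `X` when all of them end in `W`. -/
lemma mul_card_le_sum_of_neighbors_subset {n : ℕ} {G : SimpleGraph (Fin n)} {δ : ℕ}
    (hδ : ∀ i, δ ≤ degOf G i) (X W : Finset (Fin n))
    (h : ∀ x ∈ X, ∀ w, G.Adj x w → w ∈ W) :
    δ * X.card ≤ ∑ w ∈ W, (X.filter fun x => G.Adj w x).card := by
  calc δ * X.card = X.card • δ := by rw [smul_eq_mul, mul_comm]
    _ ≤ ∑ x ∈ X, (W.bipartiteAbove G.Adj x).card := by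
      refine Finset.card_nsmul_le_sum _ _ _ fun x hx => (hδ x).trans ?_
      rw [degOf_eq_card_filter]
      refine Finset.card_le_card fun w hw => ?_
      have hxw : G.Adj x w := by simpa using hw
      exact (Finset.mem_bipartiteAbove _).2 ⟨h x hx w hxw, hxw⟩
    _ = ∑ w ∈ W, (X.bipartiteBelow G.Adj w).card :=
      Finset.sum_card_bipartiteAbove_eq_sum_card_bipartiteBelow _
    _ = ∑ w ∈ W, (X.filter fun x => G.Adj w x).card := by
      simp only [Finset.bipartiteBelow, G.adj_comm]

open Classical in
/-- Two distinct vertices of a nearly regular graph are joined by a short alternating walk that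
starts and ends with an edge. -/
lemma exists_alternating {n : ℕ} {G : SimpleGraph (Fin n)} {δ Δ : ℕ}
    (hδ : ∀ i, δ ≤ degOf G i) (hΔ : ∀ i, degOf G i ≤ Δ) (hpos : 0 < δ)
    (hlt : 2 * Δ * (Δ - δ + 1) < δ * (n - 1 - Δ)) (s t : Fin n) :
    (∃ a b, G.Adj s a ∧ a ≠ b ∧ ¬ G.Adj a b ∧ G.Adj b t) ∨
      ∃ a b x y, G.Adj s a ∧ a ≠ x ∧ ¬ G.Adj a x ∧ G.Adj x y ∧ y ≠ b ∧ ¬ G.Adj y b ∧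
        G.Adj b t := by
  by_contra! hcon
  obtain ⟨h3, h5⟩ := hcon
  have hdeg := degOf_eq_card_filter G
  have hne : ∀ v, ∃ w, G.Adj v w := by
    intro v
    have : 0 < (Finset.univ.filter fun j => G.Adj v j).card := by
      rw [← hdeg]; exact hpos.trans_le (hδ v)
    obtain ⟨w, hw⟩ := Finset.card_pos.1 this
    exact ⟨w, by simpa using hw⟩
  obtain ⟨a, ha⟩ := hne s
  obtain ⟨b, hb⟩ := hne t
  set N : Fin n → Finset (Fin n) := fun v => Finset.univ.filter fun j => G.Adj v j with hN
  have mN : ∀ v w, w ∈ N v ↔ G.Adj v w := by simp [hN]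
  have cN : ∀ v, (N v).card = degOf G v := fun v => (hdeg v).symm
  set X : Finset (Fin n) := (insert a (N a))ᶜ with hX
  set W : Finset (Fin n) := insert b (N b) with hW
  have mX : ∀ x, x ∈ X ↔ x ≠ a ∧ ¬ G.Adj a x := by simp [hX, mN]
  have hXc : n - 1 - Δ ≤ X.card := by
    have h1 := Finset.card_compl (insert a (N a))
    have h2 := Finset.card_insert_le a (N a)
    have h4 := cN a
    have h5 := hΔ a
    rw [← hX] at h1
    simp only [Fintype.card_fin] at h1
    omega
  have hsub : N s ⊆ W := by
    intro w hw
    simp only [hW, Finset.mem_insert, mN] at hw ⊢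
    by_contra! hc
    exact h3 w b hw hc.1 (fun h => hc.2 h.symm) hb.symm
  have hWc : W.card ≤ Δ + 1 := by
    have : W.card ≤ (N b).card + 1 := Finset.card_insert_le b (N b)
    have := cN b
    have := hΔ b
    omega
  have hcount := mul_card_le_sum_of_neighbors_subset hδ X W (by
    intro x hx w hxw
    rw [mX] at hx
    simp only [hW, Finset.mem_insert, mN]
    by_contra! hc
    exact h5 a b x w ha hx.1.symm hx.2 hxw hc.1 (fun h => hc.2 h.symm) hb.symm)
  rw [← Finset.sum_sdiff hsub] at hcount
  have hout : ∑ w ∈ W \ N s, (X.filter fun x => G.Adj w x).card ≤ (Δ - δ + 1) * Δ := by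
    refine (Finset.sum_le_card_nsmul _ _ Δ fun w _ => ?_).trans ?_
    · refine le_trans (Finset.card_le_card ?_) (hdeg w ▸ hΔ w)
      exact Finset.filter_subset_filter _ (Finset.subset_univ _)
    · rw [smul_eq_mul]
      refine Nat.mul_le_mul_right _ ?_
      have h1 := Finset.card_sdiff_add_card_eq_card hsub
      have h2 := cN s
      have h4 := hδ s
      omega
  have hin : ∑ w ∈ N s, (X.filter fun x => G.Adj w x).card ≤ Δ * (Δ - δ + 1) := by
    refine (Finset.sum_le_card_nsmul _ _ (Δ - δ + 1) fun w hw => ?_).trans ?_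
    · have hws : G.Adj s w := (mN s w).1 hw
      have hdisj : Disjoint (X.filter fun x => G.Adj w x) ((N t).erase w) := by
        rw [Finset.disjoint_left]
        intro x hx hx'
        simp only [Finset.mem_filter, mX, Finset.mem_erase, mN] at hx hx'
        exact h3 a x ha hx.1.1.symm hx.1.2 hx'.2.symm
      have hsub' : (X.filter fun x => G.Adj w x) ∪ (N t).erase w ⊆ N w := by
        intro x hx
        simp only [Finset.mem_union, Finset.mem_filter, Finset.mem_erase, mN] at hx ⊢
        rcases hx with hx | hx
        · exact hx.2
        · by_contra hc
          exact h3 w x hws hx.1.symm hc hx.2.symm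
      have h1 := Finset.card_le_card hsub'
      rw [Finset.card_union_of_disjoint hdisj, cN] at h1
      have h2 := Finset.pred_card_le_card_erase (s := N t) (a := w)
      have h4 := cN t
      have h5 := hδ t
      have h6 := hΔ w
      omega
    · rw [smul_eq_mul, cN]
      exact Nat.mul_le_mul_right _ (hΔ s)
  have hmul := Nat.mul_le_mul_left δ hXc
  nlinarith

open Classical in
/-- In a sparse graph any two vertices are joined, in the complement, by an alternating walk of
length three. -/
lemma exists_alternating_compl_of_sparse {n : ℕ} {G : SimpleGraph (Fin n)} {δ Δ : ℕ}
    (hδ : ∀ i, δ ≤ degOf G i) (hΔ : ∀ i, degOf G i ≤ Δ)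
    (hlt : (Δ + 1) * Δ < δ * (n - 1 - Δ)) (s t : Fin n) :
    ∃ a b, Gᶜ.Adj s a ∧ a ≠ b ∧ ¬ Gᶜ.Adj a b ∧ Gᶜ.Adj b t := by
  by_contra! hcon
  have hdeg := degOf_eq_card_filter G
  set N : Fin n → Finset (Fin n) := fun v => Finset.univ.filter fun j => G.Adj v j with hN
  have mN : ∀ v w, w ∈ N v ↔ G.Adj v w := by simp [hN]
  have cN : ∀ v, (N v).card = degOf G v := fun v => (hdeg v).symm
  have hXc : n - 1 - Δ ≤ (insert s (N s))ᶜ.card := by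
    have h1 := Finset.card_compl (insert s (N s))
    have h2 := Finset.card_insert_le s (N s)
    have h4 := cN s
    have h5 := hΔ s
    simp only [Fintype.card_fin] at h1
    omega
  have hWc : (insert t (N t)).card ≤ Δ + 1 := by
    have := Finset.card_insert_le t (N t)
    have := cN t
    have := hΔ t
    omega
  have hcount := mul_card_le_sum_of_neighbors_subset hδ (insert s (N s))ᶜ (insert t (N t)) (by
    intro x hx w hxw
    simp only [Finset.mem_compl, Finset.mem_insert, mN, not_or] at hx ⊢
    by_contra! hc
    refine hcon x w ?_ hxw.ne ?_ ?_
    · rw [SimpleGraph.compl_adj]; exact ⟨Ne.symm hx.1, hx.2⟩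
    · rw [SimpleGraph.compl_adj]; tauto
    · rw [SimpleGraph.compl_adj]; exact ⟨hc.1, fun h => hc.2 h.symm⟩)
  have hsum : ∑ w ∈ insert t (N t), ((insert s (N s))ᶜ.filter fun x => G.Adj w x).card
      ≤ (Δ + 1) * Δ := by
    refine (Finset.sum_le_card_nsmul _ _ Δ fun w _ => ?_).trans ?_
    · refine le_trans (Finset.card_le_card ?_) (hdeg w ▸ hΔ w)
      exact Finset.filter_subset_filter _ (Finset.subset_univ _)
    · rw [smul_eq_mul]
      exact Nat.mul_le_mul_right _ hWc
  have hmul := Nat.mul_le_mul_left δ hXc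
  omega

/-- If every graph in `S` can be turned into one in `T` by toggling a short walk, then `S` is at
most polynomially larger than `T`. -/
lemma ncard_le_of_walkParity {n : ℕ} {S T : Set (SimpleGraph (Fin n))}
    (h : ∀ G ∈ S, ∃ p : Fin 6 → Fin n, symmDiff G (walkParity p) ∈ T) :
    S.ncard ≤ 1 * n ^ 6 * T.ncard := by
  have hsub : S ⊆ (fun x : SimpleGraph (Fin n) × (Fin 6 → Fin n) =>
      symmDiff x.1 (walkParity x.2)) '' (T ×ˢ Set.univ) := by
    intro G hG
    obtain ⟨p, hp⟩ := h G hG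
    exact ⟨(symmDiff G (walkParity p), p), ⟨hp, trivial⟩, symmDiff_symmDiff_cancel_right _ _⟩
  calc S.ncard ≤ _ := Set.ncard_le_ncard hsub (Set.toFinite _)
    _ ≤ (T ×ˢ (Set.univ : Set (Fin 6 → Fin n))).ncard := Set.ncard_image_le (Set.toFinite _)
    _ = 1 * n ^ 6 * T.ncard := by
      rw [Set.ncard_prod, Set.ncard_univ, Nat.card_eq_fintype_card]
      simp [mul_comm]

lemma exists_ne_lt_of_sum {n : ℕ} {f g : Fin n → ℕ} (hfg' : ∀ i, g i ≤ f i + 1)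
    (hsum : ∑ i, f i + 2 ≤ ∑ i, g i) : ∃ s t, s ≠ t ∧ f s < g s ∧ f t < g t := by
  have h1 : ∑ i, g i ≤ ∑ i, f i + (Finset.univ.filter fun i => f i < g i).card := by
    rw [Finset.card_filter, ← Finset.sum_add_distrib]
    refine Finset.sum_le_sum fun i _ => ?_
    have := hfg' i
    split_ifs <;> omega
  obtain ⟨s, hs, t, ht, hst⟩ := Finset.one_lt_card.1
    (show 1 < (Finset.univ.filter fun i => f i < g i).card by omega)
  exact ⟨s, t, hst, by simpa using hs, by simpa using ht⟩

/-- A degree change of one at two distinct vertices changes the number of edges by one. -/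
lemma edgeSet_ncard_of_degOf {n : ℕ} {G H : SimpleGraph (Fin n)} {s t : Fin n}
    (h : ∀ v, (degOf H v : ℤ) =
      degOf G v - (if v = s then 1 else 0) - (if v = t then 1 else 0)) :
    H.edgeSet.ncard + 1 = G.edgeSet.ncard := by
  have h1 : ((∑ i, degOf H i : ℕ) : ℤ) = (∑ i, degOf G i : ℕ) - 1 - 1 := by
    push_cast
    simp [h, Finset.sum_sub_distrib]
  rw [sum_degOf, sum_degOf] at h1
  push_cast at h1
  omega

lemma compl_symmDiff_left_eq {n : ℕ} (G F : SimpleGraph (Fin n)) :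
    (symmDiff Gᶜ F)ᶜ = symmDiff G F := by
  rw [compl_symmDiff, bihimp_def, symmDiff_def]
  simp [sdiff_eq, himp_eq, sup_comm, inf_sup_left, inf_sup_right]
  ac_rfl

/-- The numerical inequalities behind the switching argument. -/
lemma near_regular_inequalities {α ρ : ℝ} (hα : α < 1 / 2) (hρ0 : 0 < ρ) (hρ : ρ < 1)
    {n r : ℕ} (hn : ⌈(1000 / ρ) ^ 2⌉₊ ≤ n) (hr : 2 ≤ r) (hrn : (r : ℝ) ≤ (1 - ρ) * n) {δ Δ : ℕ}
    (hδ : (r : ℝ) - (r : ℝ) ^ α ≤ δ) (hΔ : (Δ : ℝ) ≤ (r : ℝ) + (r : ℝ) ^ α) (hle : δ ≤ Δ) :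
    0 < δ ∧ Δ + 1 < n ∧ 2 * Δ * (Δ - δ + 1) < δ * (n - 1 - Δ) ∧
      ((Δ + 1) * Δ < δ * (n - 1 - Δ) ∨
        2 * (n - 1 - δ) * (Δ - δ + 1) < (n - 1 - Δ) * δ) := by
  have hr' : (2 : ℝ) ≤ r := by exact_mod_cast hr
  set σ := Real.sqrt r with hσ
  set τ := Real.sqrt n with hτ
  have hσσ : σ * σ = r := Real.mul_self_sqrt (by positivity)
  have hττ : τ * τ = n := Real.mul_self_sqrt (by positivity)
  have hσ0 : 0 ≤ σ := Real.sqrt_nonneg _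
  have hτ0 : 0 ≤ τ := Real.sqrt_nonneg _
  have hg : (r : ℝ) ^ α ≤ σ := by
    rw [hσ, Real.sqrt_eq_rpow]
    exact Real.rpow_le_rpow_of_exponent_le (by linarith) hα.le
  have hτK : 1000 ≤ ρ * τ := by
    have h1 : (1000 / ρ) ^ 2 ≤ (n : ℝ) := (Nat.le_ceil _).trans (by exact_mod_cast hn)
    have h2 : 1000 / ρ ≤ τ := Real.le_sqrt_of_sq_le h1
    rwa [div_le_iff₀ hρ0, mul_comm] at h2
  have hτ1 : 1000 ≤ τ := by nlinarith only [hτK, hρ, hτ0]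
  have hστ : σ ≤ τ := Real.sqrt_le_sqrt (by nlinarith only [hrn, hρ0, hττ, hτ0])
  have hσ1 : 1.41 ≤ σ := by
    apply Real.le_sqrt_of_sq_le
    norm_num
    linarith
  have hσr : σ ≤ 0.71 * r := by nlinarith only [hσσ, hσ1]
  have hδr : 0.29 * r ≤ (δ : ℝ) := by linarith
  have hΔr : (Δ : ℝ) ≤ 1.71 * r := by linarith
  have hgap : (Δ : ℝ) - δ + 1 ≤ 2 * σ + 1 := by linarith
  have hρn : 1000 * τ ≤ ρ * n := by rw [← hττ]; nlinarith only [hτK, hτ0]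
  have hfree : ρ * n / 2 ≤ (n : ℝ) - 1 - Δ := by linarith
  have hpos : (0 : ℝ) < δ := by linarith
  have hΔn : Δ + 1 < n := by
    have : (Δ : ℝ) + 1 < n := by linarith
    exact_mod_cast this
  have c1 : ((Δ - δ : ℕ) : ℝ) = (Δ : ℝ) - δ := Nat.cast_sub hle
  have c2 : ((n - 1 - Δ : ℕ) : ℝ) = (n : ℝ) - 1 - Δ := by
    rw [Nat.cast_sub (by omega), Nat.cast_sub (by omega)]; simp
  have c3 : ((n - 1 - δ : ℕ) : ℝ) = (n : ℝ) - 1 - δ := by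
    rw [Nat.cast_sub (by omega), Nat.cast_sub (by omega)]; simp
  have hle' : (δ : ℝ) ≤ Δ := by exact_mod_cast hle
  refine ⟨by exact_mod_cast hpos, hΔn, ?_, ?_⟩
  · have h1 : 2 * (Δ : ℝ) * (Δ - δ + 1) ≤ 2 * (1.71 * r) * (2 * τ + 1) := by
      gcongr
      linarith
    have h2 : 0.29 * r * (ρ * n / 2) ≤ (δ : ℝ) * (n - 1 - Δ) := by gcongr
    have h3 : 2 * (1.71 * (r : ℝ)) * (2 * τ + 1) < 0.29 * r * (ρ * n / 2) := by
      have : 2 * 1.71 * (2 * τ + 1) < 0.29 * (ρ * n / 2) := by linarith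
      nlinarith only [this, hr']
    have h4 : 2 * (Δ : ℝ) * (Δ - δ + 1) < (δ : ℝ) * (n - 1 - Δ) := by linarith
    rw [← c1, ← c2] at h4
    exact_mod_cast h4
  · have hn1 : (1000000 : ℝ) ≤ n := by nlinarith only [hτ1, hττ]
    rcases le_total (100 * (r : ℝ)) n with h | h
    · left
      have h1 : ((Δ : ℝ) + 1) * Δ ≤ (0.0171 * n + 1) * (1.71 * r) :=
        mul_le_mul (by linarith) hΔr (by linarith) (by linarith)
      have h2 : 0.29 * r * (0.9 * n) ≤ (δ : ℝ) * (n - 1 - Δ) :=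
        mul_le_mul hδr (by linarith) (by linarith) (by linarith)
      have h3 : (0.0171 * (n : ℝ) + 1) * (1.71 * r) < 0.29 * r * (0.9 * n) := by
        have : (0.0171 * (n : ℝ) + 1) * 1.71 < 0.29 * (0.9 * n) := by linarith
        nlinarith only [this, hr']
      have h4 : ((Δ : ℝ) + 1) * Δ < (δ : ℝ) * (n - 1 - Δ) := by linarith
      rw [← c2] at h4
      exact_mod_cast h4
    · right
      have hστ' : τ ≤ 10 * σ := by nlinarith only [h, hσσ, hττ, hσ0, hτ0]
      have hσK : 100 ≤ ρ * σ := by nlinarith only [hστ', hρ0, hτK]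
      have h1 : 2 * ((n : ℝ) - 1 - δ) * (Δ - δ + 1) ≤ 2 * n * (2 * σ + 1) :=
        mul_le_mul (by linarith) hgap (by linarith) (by linarith)
      have h2 : (ρ * n / 2) * (0.29 * r) ≤ ((n : ℝ) - 1 - Δ) * δ :=
        mul_le_mul hfree hδr (by linarith) (by nlinarith only [hfree, hρn, hτ1])
      have h3 : 2 * (n : ℝ) * (2 * σ + 1) < (ρ * n / 2) * (0.29 * r) := by
        have : 2 * (2 * σ + 1) < ρ / 2 * (0.29 * r) := by rw [← hσσ]; nlinarith only [hσK, hσ1]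
        nlinarith only [this, hn1]
      have h4 : 2 * ((n : ℝ) - 1 - δ) * (Δ - δ + 1) < ((n : ℝ) - 1 - Δ) * δ := by linarith
      rw [← c1, ← c2, ← c3] at h4
      exact_mod_cast h4

/-- For near-regular degree intervals of size at most one, consecutive ratios of the
sequence `m ↦ |G_m(ℓ,u)|` are polynomially bounded. -/
theorem consecutive_ratios_poly_bounded (α ρ : ℝ) (hα0 : 0 < α) (hα : α < 1 / 2)
    (hρ0 : 0 < ρ) (hρ : ρ < 1) :
    ∃ c k n₀ : ℕ, 0 < c ∧ ∀ n : ℕ, n₀ ≤ n → ∀ r : ℕ, 2 ≤ r → (r : ℝ) ≤ (1 - ρ) * n →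
      ∀ ℓ u : Fin n → ℕ,
        (∀ i, ℓ i ≤ u i ∧ (r : ℝ) - (r : ℝ) ^ α ≤ (ℓ i : ℝ) ∧
          (u i : ℝ) ≤ (r : ℝ) + (r : ℝ) ^ α ∧ u i ≤ ℓ i + 1) →
        ∀ m : ℕ, (∑ i, ℓ i) ≤ 2 * m → 2 * (m + 1) ≤ (∑ i, u i) →
          (Gm n ℓ u (m + 1)).ncard ≤ c * n ^ k * (Gm n ℓ u m).ncard ∧
          (Gm n ℓ u m).ncard ≤ c * n ^ k * (Gm n ℓ u (m + 1)).ncard := by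
  refine ⟨1, 6, ⌈(1000 / ρ) ^ 2⌉₊, one_pos, fun n hn r hr hrn ℓ u hlu m hm1 hm2 => ?_⟩
  set δ := ⌈(r : ℝ) - (r : ℝ) ^ α⌉₊ with hδdef
  set Δ := ⌊(r : ℝ) + (r : ℝ) ^ α⌋₊ with hΔdef
  have hg0 : 0 ≤ (r : ℝ) ^ α := by positivity
  have hδl : ∀ i, δ ≤ ℓ i := fun i => Nat.ceil_le.2 (hlu i).2.1
  have huΔ : ∀ i, u i ≤ Δ := fun i => Nat.le_floor (hlu i).2.2.1
  have hle : δ ≤ Δ :=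
    have hn0 : 0 < n := (Nat.ceil_pos.2 (by positivity)).trans_le hn
    (hδl ⟨0, hn0⟩).trans ((hlu _).1.trans (huΔ _))
  obtain ⟨hpos, hΔn, hineq, hineq'⟩ := near_regular_inequalities hα hρ0 hρ hn hr hrn
    (Nat.le_ceil _) (Nat.floor_le (by positivity)) hle
  have hdeg : ∀ {k : ℕ} {G : SimpleGraph (Fin n)}, G ∈ Gm n ℓ u k →
      (∀ i, δ ≤ degOf G i) ∧ ∀ i, degOf G i ≤ Δ := fun hG =>
    ⟨fun i => (hδl i).trans (hG.1 i).1, fun i => (hG.1 i).2.trans (huΔ i)⟩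
  constructor
  · refine ncard_le_of_walkParity fun G hG => ?_
    obtain ⟨hGδ, hGΔ⟩ := hdeg hG
    have hsum := sum_degOf G
    rw [hG.2] at hsum
    obtain ⟨s, t, hst, hs, ht⟩ := exists_ne_lt_of_sum (f := ℓ) (g := degOf G)
      (fun i => (hG.1 i).2.trans (hlu i).2.2.2) (by omega)
    obtain ⟨p, hp⟩ := exists_walkParity_of_alternating hst
      (Or.inr (exists_alternating hGδ hGΔ hpos hineq s t))
    refine ⟨p, fun i => ?_, ?_⟩
    · have h1 := hp i
      have h2 := hG.1 i
      split_ifs at h1 with h3 h4 h4 <;> subst_vars <;> first | exact absurd rfl hst | omega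
    · have h1 := edgeSet_ncard_of_degOf hp
      have h2 := hG.2
      omega
  · refine ncard_le_of_walkParity fun G hG => ?_
    obtain ⟨hGδ, hGΔ⟩ := hdeg hG
    have hsum := sum_degOf G
    rw [hG.2] at hsum
    obtain ⟨s, t, hst, hs, ht⟩ := exists_ne_lt_of_sum (f := degOf G) (g := u)
      (fun i => (hlu i).2.2.2.trans (Nat.add_le_add_right (hG.1 i).1 1)) (by omega)
    have hwalk : (∃ a b, Gᶜ.Adj s a ∧ a ≠ b ∧ ¬ Gᶜ.Adj a b ∧ Gᶜ.Adj b t) ∨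
        ∃ a b x y, Gᶜ.Adj s a ∧ a ≠ x ∧ ¬ Gᶜ.Adj a x ∧ Gᶜ.Adj x y ∧ y ≠ b ∧ ¬ Gᶜ.Adj y b ∧
          Gᶜ.Adj b t := by
      rcases hineq' with h | h
      · exact Or.inl (exists_alternating_compl_of_sparse hGδ hGΔ h s t)
      · refine exists_alternating (δ := n - 1 - Δ) (Δ := n - 1 - δ) (fun i => ?_) (fun i => ?_)
          (by omega) ?_ s t
        · have := degOf_compl_add G i
          have := hGΔ i
          omega
        · have := degOf_compl_add G i
          have := hGδ i
          omega
        · rwa [show n - 1 - δ - (n - 1 - Δ) = Δ - δ by omega,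
            show n - 1 - (n - 1 - δ) = δ by omega]
    obtain ⟨p, hp⟩ := exists_walkParity_of_alternating hst (Or.inr hwalk)
    have hp' : ∀ v, (degOf G v : ℤ) = degOf (symmDiff G (walkParity p)) v -
        (if v = s then 1 else 0) - (if v = t then 1 else 0) := by
      intro v
      have h1 := hp v
      have h2 := degOf_compl_add G v
      have h3 := degOf_compl_add (symmDiff Gᶜ (walkParity p)) v
      rw [compl_symmDiff_left_eq] at h3
      omega
    refine ⟨p, fun i => ?_, ?_⟩
    · have h1 := hp' i
      have h2 := hG.1 i
      split_ifs at h1 with h3 h4 h4 <;> subst_vars <;> first | exact absurd rfl hst | omega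
    · have h1 := edgeSet_ncard_of_degOf hp'
      have h2 := hG.2
      omega
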